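/- arXiv:1405.3414 — 2 statements merged into one kernel-verified Lean document; each statement's English description precedes it below -/
import Mathlib

section
/- Let b ≥ 0 be an integer and let ε := 0 if b is even and ε := 1 if b is odd. Then for every real number X with X ≠ p, X ≠ 1, X ≠ −1 and pX ≠ 1: F_p(b,b;X) = F_p(ε,ε;X) + ((X + p)(X − 1)/(X − p)) · ( pX(1 − p)·((pX)^{b} − (pX)^{ε})/(pX − 1) + X²(p − p^{−1}X)·(X^{2b} − X^{2ε})/(X² − 1) ). -/
/-- The symbol `[u,v]` of Hironaka, for integers `u ≥ v ≥ 0`. -/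
noncomputable def bsym (p u v : ℕ) : ℚ :=
  (∏ i ∈ Finset.Icc 1 u, (1 - (-(p : ℚ))⁻¹ ^ i)) /
    ((∏ i ∈ Finset.Icc 1 v, (1 - (-(p : ℚ))⁻¹ ^ i)) *
      (∏ i ∈ Finset.Icc 1 (u - v), (1 - (-(p : ℚ))⁻¹ ^ i)))

/-- For a pair `a = (a₁, a₂)`, the quantity `a'_i = #{j ∈ {1,2} : a_j ≥ i}`. -/
def dualCt (a : ℕ × ℕ) (i : ℕ) : ℕ :=
  (if i ≤ a.1 then 1 else 0) + (if i ≤ a.2 then 1 else 0)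

/-- Hironaka's local factor `I_j(μ, λ)`, for pairs `μ = (c,d)`, `λ = (λ₁,λ₂)`. -/
noncomputable def hirI (p : ℕ) (μ lam : ℕ × ℕ) (j : ℕ) : ℚ :=
  ∑ i ∈ Finset.Icc (dualCt μ (j + 1))
      (min (dualCt (lam.1 + 1, lam.2 + 1) (j + 1)) (dualCt μ j)),
    (-(p : ℚ)) ^ (i * (2 * dualCt (lam.1 + 1, lam.2 + 1) (j + 1) + 1 - i) / 2) *
      bsym p (dualCt (lam.1 + 1, lam.2 + 1) (j + 1) - dualCt μ (j + 1))
        (dualCt (lam.1 + 1, lam.2 + 1) (j + 1) - i) *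
      bsym p (dualCt (lam.1 + 1, lam.2 + 1) j - i)
        (dualCt (lam.1 + 1, lam.2 + 1) j - dualCt μ j)

/-- `ε_n = 0` if `n = 0` and `1` otherwise. -/
def epsn (n : ℕ) : ℕ := if n = 0 then 0 else 1

/-- The specialization `F_p(a,b;X)` of Hironaka's formula for Hermitian representation
densities: `α(diag(p,1) ⊕ 1_r, diag(p^a, p^b)) = F_p(a,b;(-p)^{-r})`. -/
noncomputable def Fp (p a b : ℕ) (X : ℝ) : ℝ :=
  ∑ c ∈ Finset.range (a + 2), ∑ d ∈ Finset.range (min c (b + 1) + 1),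
    (-1 : ℝ) ^ d * ((p : ℝ) ^ (2 * d + c))⁻¹ * X ^ (c + d) *
      (-(p : ℝ)) ^ (epsn c + epsn d) *
      ∏ j ∈ Finset.Icc 1 (a + 1), ((hirI p (c, d) (a, b) j : ℚ) : ℝ)

/-- The local factor as a function of the column counts `u = λ̃'_{j+1}`, `w = λ̃'_j`,
`n = μ'_{j+1}` and `m = μ'_j`. -/
noncomputable def hirCore (p u w n m : ℕ) : ℚ :=
  ∑ i ∈ Finset.Icc n (min u m),
    (-(p : ℚ)) ^ (i * (2 * u + 1 - i) / 2) * bsym p (u - n) (u - i) * bsym p (w - i) (w - m)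

theorem hirI_eq_hirCore (p : ℕ) (μ lam : ℕ × ℕ) (j : ℕ) :
    hirI p μ lam j = hirCore p (dualCt (lam.1 + 1, lam.2 + 1) (j + 1))
      (dualCt (lam.1 + 1, lam.2 + 1) j) (dualCt μ (j + 1)) (dualCt μ j) := rfl

theorem one_sub_neg_inv_ne_zero {p : ℕ} (hp : 2 ≤ p) : (1 : ℚ) - (-(p : ℚ))⁻¹ ≠ 0 := by
  have h : (0 : ℚ) < (p : ℚ) := by positivity
  have : (0 : ℚ) < (p : ℚ)⁻¹ := by positivity
  rw [inv_neg]
  linarith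

theorem one_sub_neg_inv_sq_ne_zero {p : ℕ} (hp : 2 ≤ p) :
    (1 : ℚ) - (-(p : ℚ))⁻¹ ^ 2 ≠ 0 := by
  have h : (2 : ℚ) ≤ (p : ℚ) := by exact_mod_cast hp
  have h1 : (p : ℚ) ^ 2 - 1 ≠ 0 := by nlinarith
  have h2 : (p : ℚ) ≠ 0 := by positivity
  have : (1 : ℚ) - (-(p : ℚ))⁻¹ ^ 2 = ((p : ℚ) ^ 2 - 1) / (p : ℚ) ^ 2 := by
    rw [inv_neg]
    field_simp
  rw [this]
  positivity

theorem bsym_zero_zero (p : ℕ) : bsym p 0 0 = 1 := by simp [bsym]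

theorem bsym_one_zero {p : ℕ} (hp : 2 ≤ p) : bsym p 1 0 = 1 := by
  simpa [bsym] using one_sub_neg_inv_ne_zero hp

theorem bsym_one_one {p : ℕ} (hp : 2 ≤ p) : bsym p 1 1 = 1 := by
  simpa [bsym] using one_sub_neg_inv_ne_zero hp

theorem bsym_two_zero {p : ℕ} (hp : 2 ≤ p) : bsym p 2 0 = 1 := by
  have h1 := one_sub_neg_inv_ne_zero hp
  have h2 := one_sub_neg_inv_sq_ne_zero hp
  simp only [bsym, Finset.prod_Icc_succ_top (show 1 ≤ 1 + 1 by norm_num),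
    Finset.Icc_self, Finset.prod_singleton, Nat.sub_zero, pow_one]
  simpa using div_self (mul_ne_zero h1 h2)

theorem bsym_two_two {p : ℕ} (hp : 2 ≤ p) : bsym p 2 2 = 1 := by
  have h := bsym_two_zero hp
  rw [bsym] at h ⊢
  rwa [mul_comm] at h

theorem bsym_two_one {p : ℕ} (hp : 2 ≤ p) : bsym p 2 1 = 1 + (-(p : ℚ))⁻¹ := by
  have h1 := one_sub_neg_inv_ne_zero hp
  simp only [bsym, Finset.prod_Icc_succ_top (show 1 ≤ 1 + 1 by norm_num),
    Finset.Icc_self, Finset.prod_singleton, Nat.reduceSub, pow_one, Nat.reduceAdd]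
  rw [div_eq_iff (mul_ne_zero h1 h1)]
  ring

section hirCore

variable {p : ℕ}

theorem hirCore_two_zero_zero (hp : 2 ≤ p) : hirCore p 2 2 0 0 = 1 := by
  simp [hirCore, bsym_two_two hp]

theorem hirCore_two_one_one (hp : 2 ≤ p) : hirCore p 2 2 1 1 = (p : ℚ) ^ 2 := by
  simp [hirCore, bsym_one_one hp]

theorem hirCore_two_two_two (p : ℕ) : hirCore p 2 2 2 2 = -(p : ℚ) ^ 3 := by
  simp [hirCore, bsym_zero_zero]
  ring

theorem hirCore_two_zero_one (hp : 2 ≤ p) :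
    hirCore p 2 2 0 1 = (1 + (-(p : ℚ))⁻¹) * (1 + (p : ℚ) ^ 2) := by
  simp [hirCore, Finset.sum_Icc_succ_top, bsym_two_one hp, bsym_two_two hp, bsym_one_one hp]
  ring

theorem hirCore_two_one_two (hp : 2 ≤ p) :
    hirCore p 2 2 1 2 = (p : ℚ) ^ 2 * (1 - p) := by
  simp [hirCore, Finset.sum_Icc_succ_top, bsym_one_zero hp, bsym_one_one hp, bsym_zero_zero]
  ring

theorem hirCore_two_zero_two (hp : 2 ≤ p) :
    hirCore p 2 2 0 2 = (1 - (p : ℚ)) * (1 + (p : ℚ) ^ 2) := by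
  have h0 : (p : ℚ) ≠ 0 := by positivity
  simp [hirCore, Finset.sum_Icc_succ_top, bsym_one_zero hp, bsym_zero_zero,
    bsym_two_zero hp, bsym_two_one hp, bsym_two_two hp]
  field_simp
  ring

theorem hirCore_zero_zero_zero (hp : 2 ≤ p) : hirCore p 0 2 0 0 = 1 := by
  simp [hirCore, bsym_two_two hp, bsym_zero_zero]

theorem hirCore_zero_zero_one (hp : 2 ≤ p) : hirCore p 0 2 0 1 = 1 + (-(p : ℚ))⁻¹ := by
  simp [hirCore, bsym_two_one hp, bsym_zero_zero]

theorem hirCore_zero_zero_two (hp : 2 ≤ p) : hirCore p 0 2 0 2 = 1 := by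
  simp [hirCore, bsym_two_zero hp, bsym_zero_zero]

end hirCore

/-- The product of Hironaka's local factors for `μ = (c,d)` and `λ = (b,b)`. -/
noncomputable def hirProd (p c d b : ℕ) : ℚ :=
  ∏ j ∈ Finset.range (b + 1), hirI p (c, d) (b, b) (j + 1)

theorem dualCt_succ (c d j : ℕ) : dualCt (c + 1, d + 1) (j + 1) = dualCt (c, d) j := by
  simp [dualCt]

theorem dualCt_succ_zero (c j : ℕ) : dualCt (c + 1, 0) (j + 2) = dualCt (c, 0) (j + 1) := by
  simp [dualCt]

theorem hirProd_succ_succ (p c d b : ℕ) :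
    hirProd p (c + 1) (d + 1) (b + 1) =
      hirCore p 2 2 (dualCt (c, d) 1) 2 * hirProd p c d b := by
  rw [hirProd, Finset.prod_range_succ', mul_comm, hirProd]
  congr 1
  · simp [hirI_eq_hirCore, dualCt]
  refine Finset.prod_congr rfl fun j _ => ?_
  simp only [hirI_eq_hirCore, dualCt_succ]

theorem hirProd_succ_zero (p c b : ℕ) :
    hirProd p (c + 1) 0 (b + 1) =
      hirCore p 2 2 (dualCt (c, 0) 1) 1 * hirProd p c 0 b := by
  rw [hirProd, Finset.prod_range_succ', mul_comm, hirProd]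
  congr 1
  · simp [hirI_eq_hirCore, dualCt]
  refine Finset.prod_congr rfl fun j _ => ?_
  simp only [hirI_eq_hirCore, dualCt_succ, dualCt_succ_zero]

section hirProd

variable {p : ℕ}

theorem hirProd_zero_zero (hp : 2 ≤ p) (b : ℕ) : hirProd p 0 0 b = 1 := by
  induction b with
  | zero => simp [hirProd, hirI_eq_hirCore, dualCt, hirCore_zero_zero_zero hp]
  | succ b ih =>
    rw [hirProd, Finset.prod_range_succ', ← ih, hirProd]
    have : hirI p (0, 0) (b + 1, b + 1) (0 + 1) = 1 := by
      simp [hirI_eq_hirCore, dualCt, hirCore_two_zero_zero hp]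
    rw [this, mul_one]
    refine Finset.prod_congr rfl fun j _ => ?_
    simp [hirI_eq_hirCore, dualCt]

theorem hirProd_top_zero (hp : 2 ≤ p) (c : ℕ) :
    hirProd p (c + 1) 0 c = (p : ℚ) ^ (2 * c) * (1 + (-(p : ℚ))⁻¹) := by
  induction c with
  | zero => simp [hirProd, hirI_eq_hirCore, dualCt, hirCore_zero_zero_one hp]
  | succ c ih =>
    rw [hirProd_succ_zero, ih]
    simp only [dualCt, Nat.reduceLeDiff, le_add_iff_nonneg_left, zero_le, if_true, if_false,
      add_zero, hirCore_two_one_one hp]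
    ring

theorem hirProd_mid_zero (hp : 2 ≤ p) (c k : ℕ) :
    hirProd p (c + 1) 0 (c + k + 1) =
      (p : ℚ) ^ (2 * c) * (1 + (-(p : ℚ))⁻¹) * (1 + (p : ℚ) ^ 2) := by
  induction c with
  | zero =>
    rw [hirProd_succ_zero, hirProd_zero_zero hp]
    simp [dualCt, hirCore_two_zero_one hp]
  | succ c ih =>
    rw [show c + 1 + k + 1 = (c + k + 1) + 1 by ring, hirProd_succ_zero, ih]
    simp only [dualCt, Nat.reduceLeDiff, le_add_iff_nonneg_left, zero_le, if_true, if_false,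
      add_zero, hirCore_two_one_one hp]
    ring

theorem hirProd_top_diag (hp : 2 ≤ p) (d : ℕ) :
    hirProd p (d + 1) (d + 1) d = (-(p : ℚ) ^ 3) ^ d := by
  induction d with
  | zero => simp [hirProd, hirI_eq_hirCore, dualCt, hirCore_zero_zero_two hp]
  | succ d ih =>
    rw [hirProd_succ_succ, ih]
    simp only [dualCt, le_add_iff_nonneg_left, zero_le, if_true, Nat.reduceAdd,
      hirCore_two_two_two]
    ring

theorem hirProd_mid_diag (hp : 2 ≤ p) (d k : ℕ) :
    hirProd p (d + 1) (d + 1) (d + k + 1) =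
      (-(p : ℚ) ^ 3) ^ d * ((1 - (p : ℚ)) * (1 + (p : ℚ) ^ 2)) := by
  induction d with
  | zero =>
    rw [hirProd_succ_succ, hirProd_zero_zero hp]
    simp [dualCt, hirCore_two_zero_two hp]
  | succ d ih =>
    rw [show d + 1 + k + 1 = (d + k + 1) + 1 by ring, hirProd_succ_succ, ih]
    simp only [dualCt, le_add_iff_nonneg_left, zero_le, if_true, Nat.reduceAdd,
      hirCore_two_two_two]
    ring

theorem hirProd_offdiag (hp : 2 ≤ p) (c d b : ℕ) :
    hirProd p (c + d + 2) (d + 1) (b + d + 1) =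
      (-(p : ℚ) ^ 3) ^ d * ((p : ℚ) ^ 2 * (1 - p)) * hirProd p (c + 1) 0 b := by
  induction d with
  | zero =>
    rw [hirProd_succ_succ]
    simp [dualCt, hirCore_two_one_two hp]
  | succ d ih =>
    rw [show c + (d + 1) + 2 = (c + d + 2) + 1 by ring,
      show b + (d + 1) + 1 = (b + d + 1) + 1 by ring, hirProd_succ_succ, ih]
    have : dualCt (c + d + 2, d + 1) 1 = 2 := by simp [dualCt]
    rw [this, hirCore_two_two_two]
    ring

end hirProd

/-- The contribution of a fixed `c` to `F_p(b,b;X)`. -/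
noncomputable def FpRow (p b : ℕ) (X : ℝ) (c : ℕ) : ℝ :=
  ∑ d ∈ Finset.range (c + 1), (-1 : ℝ) ^ d * ((p : ℝ) ^ (2 * d + c))⁻¹ * X ^ (c + d) *
    (-(p : ℝ)) ^ (epsn c + epsn d) * (hirProd p c d b : ℝ)

theorem Fp_eq_sum_FpRow (p b : ℕ) (X : ℝ) :
    Fp p b b X = ∑ c ∈ Finset.range (b + 2), FpRow p b X c := by
  refine Finset.sum_congr rfl fun c hc => ?_
  rw [Finset.mem_range] at hc
  rw [min_eq_left (by omega), FpRow]
  refine Finset.sum_congr rfl fun d _ => ?_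
  rw [hirProd, Rat.cast_prod, Finset.range_eq_Ico,
    Finset.prod_Ico_add' (fun j => ((hirI p (c, d) (b, b) j : ℚ) : ℝ)) 0 (b + 1) 1]
  rfl

theorem FpRow_zero {p : ℕ} (hp : 2 ≤ p) (b : ℕ) (X : ℝ) : FpRow p b X 0 = 1 := by
  simp [FpRow, epsn, hirProd_zero_zero hp]

/-- A row of `F_p` in closed form, given the values of the products of local factors. -/
theorem FpRow_succ_of {p : ℕ} (hp : 2 ≤ p) (b c : ℕ) {X : ℝ} (hX : X ≠ p) (s t : ℚ)
    (h0 : hirProd p (c + 1) 0 b = (p : ℚ) ^ (2 * c) * (1 + (-(p : ℚ))⁻¹) * t)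
    (h1 : ∀ e d, e + d + 1 = c → hirProd p (c + 1) (d + 1) b =
      (-(p : ℚ) ^ 3) ^ d * ((p : ℚ) ^ 2 * (1 - p)) *
        ((p : ℚ) ^ (2 * e) * (1 + (-(p : ℚ))⁻¹) * t))
    (h2 : hirProd p (c + 1) (c + 1) b = (-(p : ℚ) ^ 3) ^ c * s) :
    FpRow p b X (c + 1) =
      t * (1 - p) / p ^ 2 * (p ^ (c + 1) * X ^ (c + 1) +
        (1 - p) * X * (p * X ^ (2 * c + 1) - p ^ (c + 1) * X ^ (c + 1)) / (X - p))
        - s * X ^ (2 * c + 2) / p := by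
  have hp0 : (p : ℝ) ≠ 0 := by positivity
  have hXp : X - p ≠ 0 := sub_ne_zero.mpr hX
  have hmid : ∀ d ∈ Finset.range c,
      (-1 : ℝ) ^ (d + 1) * ((p : ℝ) ^ (2 * (d + 1) + (c + 1)))⁻¹ * X ^ (c + 1 + (d + 1)) *
        (-(p : ℝ)) ^ (epsn (c + 1) + epsn (d + 1)) * (hirProd p (c + 1) (d + 1) b : ℝ) =
      t * (1 - p) ^ 2 / p ^ 2 * (p ^ (c + 1) * X ^ (c + 1)) * (X / p) * (X / p) ^ d := by
    intro d hd
    rw [Finset.mem_range] at hd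
    obtain ⟨e, rfl⟩ : ∃ e, c = e + d + 1 := ⟨c - d - 1, by omega⟩
    rw [h1 e d rfl]
    have hs : ((-1 : ℝ) ^ d) ^ 2 = 1 := by rw [← pow_mul, mul_comm, pow_mul]; simp
    push_cast
    simp only [epsn, Nat.add_eq_zero_iff, one_ne_zero, and_false, if_false]
    rw [neg_pow ((p : ℝ) ^ 3) d, inv_neg, div_pow]
    have : (-1 : ℝ) ^ (d + 1) = -(-1) ^ d := by ring
    rw [this]
    generalize (-1 : ℝ) ^ d = σ at hs ⊢
    field_simp
    linear_combination
      (X ^ 3 * X ^ e * X ^ (d * 2) * p ^ 6 * p ^ (e * 2) * p ^ (d * 4) * t * (1 - p) ^ 2) * hs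
  have hgeom : (∑ d ∈ Finset.range c, (X / p) ^ d) * (X - p) = p * ((X / p) ^ c - 1) := by
    rw [← geom_sum_mul]
    field_simp
  have hgeom' : ∑ d ∈ Finset.range c, (X / p) ^ d = p * ((X / p) ^ c - 1) / (X - p) := by
    rw [eq_div_iff hXp, hgeom]
  rw [FpRow, Finset.sum_range_succ, Finset.sum_range_succ', Finset.sum_congr rfl hmid,
    ← Finset.mul_sum, hgeom', h0, h2]
  have hs : ((-1 : ℝ) ^ c) ^ 2 = 1 := by rw [← pow_mul, mul_comm, pow_mul]; simp
  push_cast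
  simp only [epsn, Nat.add_eq_zero_iff, one_ne_zero, and_false, if_false, if_true]
  rw [neg_pow ((p : ℝ) ^ 3) c, inv_neg, div_pow]
  have : (-1 : ℝ) ^ (c + 1) = -(-1) ^ c := by ring
  rw [this]
  generalize (-1 : ℝ) ^ c = σ at hs ⊢
  field_simp
  linear_combination (X ^ 2 * X ^ (c * 2) * p ^ 5 * p ^ (c * 5) * s * (p - X)) * hs

theorem FpRow_top {p : ℕ} (hp : 2 ≤ p) (c : ℕ) {X : ℝ} (hX : X ≠ p) :
    FpRow p c X (c + 1) =
      (1 - p) / p ^ 2 * (p ^ (c + 1) * X ^ (c + 1) +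
        (1 - p) * X * (p * X ^ (2 * c + 1) - p ^ (c + 1) * X ^ (c + 1)) / (X - p))
        - X ^ (2 * c + 2) / p := by
  have h := FpRow_succ_of hp c c hX 1 1 (by rw [hirProd_top_zero hp, mul_one]) ?_
    (by rw [hirProd_top_diag hp, mul_one])
  · simpa using h
  · rintro e d rfl
    have := hirProd_offdiag hp e d e
    rw [hirProd_top_zero hp] at this
    rw [mul_one, ← this]

theorem FpRow_mid {p : ℕ} (hp : 2 ≤ p) (c k : ℕ) {X : ℝ} (hX : X ≠ p) :
    FpRow p (c + k + 1) X (c + 1) =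
      (1 + p ^ 2) * (1 - p) / p ^ 2 * (p ^ (c + 1) * X ^ (c + 1) +
        (1 - p) * X * (p * X ^ (2 * c + 1) - p ^ (c + 1) * X ^ (c + 1)) / (X - p))
        - (1 - p) * (1 + p ^ 2) * X ^ (2 * c + 2) / p := by
  have h := FpRow_succ_of hp (c + k + 1) c hX ((1 - (p : ℚ)) * (1 + (p : ℚ) ^ 2))
    (1 + (p : ℚ) ^ 2) (hirProd_mid_zero hp c k) ?_ (hirProd_mid_diag hp c k)
  · simpa using h
  · rintro e d rfl
    have := hirProd_offdiag hp e d (e + k + 1)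
    rw [hirProd_mid_zero hp] at this
    rw [← this]
    congr 1
    ring

/-- Rows below the top one do not depend on `b`. -/
theorem FpRow_stable {p : ℕ} (hp : 2 ≤ p) {b b' c : ℕ} (hb : c ≤ b) (hb' : c ≤ b') {X : ℝ}
    (hX : X ≠ p) : FpRow p b X c = FpRow p b' X c := by
  cases c with
  | zero => rw [FpRow_zero hp, FpRow_zero hp]
  | succ c =>
    obtain ⟨k, rfl⟩ := Nat.exists_eq_add_of_le hb
    obtain ⟨k', rfl⟩ := Nat.exists_eq_add_of_le hb'
    rw [show c + 1 + k = c + k + 1 by ring, show c + 1 + k' = c + k' + 1 by ring,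
      FpRow_mid hp _ _ hX, FpRow_mid hp _ _ hX]

theorem Fp_add_two {p : ℕ} (hp : 2 ≤ p) (b : ℕ) {X : ℝ} (hX : X ≠ p) :
    Fp p (b + 2) (b + 2) X = Fp p b b X + (X + p) * (X - 1) / (X - p) *
      (p * X * (1 - p) * ((p * X) ^ b * (p * X + 1)) +
        X ^ 2 * (p - (p : ℝ)⁻¹ * X) * (X ^ (2 * b) * (X ^ 2 + 1))) := by
  have hp0 : (p : ℝ) ≠ 0 := by positivity
  have hXp : X - p ≠ 0 := sub_ne_zero.mpr hX
  have hst : ∑ c ∈ Finset.range (b + 1), FpRow p (b + 2) X c =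
      ∑ c ∈ Finset.range (b + 1), FpRow p b X c := by
    refine Finset.sum_congr rfl fun c hc => ?_
    rw [Finset.mem_range] at hc
    exact FpRow_stable hp (by omega) (by omega) hX
  have h1 := FpRow_mid hp b 1 hX
  have h2 := FpRow_mid hp (b + 1) 0 hX
  have h3 := FpRow_top hp (b + 2) hX
  rw [Fp_eq_sum_FpRow, Fp_eq_sum_FpRow, Finset.sum_range_succ, Finset.sum_range_succ,
    Finset.sum_range_succ, Finset.sum_range_succ _ (b + 1), hst, FpRow_top hp b hX]
  simp only [add_zero, Nat.add_assoc, Nat.reduceAdd] at h1 h2 h3 ⊢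
  rw [h1, h2, h3]
  field_simp
  ring

theorem Fp_diag_add_two_mul {p : ℕ} (hp : 2 ≤ p) (e k : ℕ) {X : ℝ} (hX : X ≠ p)
    (hX1 : X ^ 2 ≠ 1) (hpX : (p : ℝ) * X ≠ 1) :
    Fp p (e + 2 * k) (e + 2 * k) X = Fp p e e X + (X + p) * (X - 1) / (X - p) *
      (p * X * (1 - p) * (((p * X) ^ (e + 2 * k) - (p * X) ^ e) / (p * X - 1)) +
        X ^ 2 * (p - (p : ℝ)⁻¹ * X) *
          ((X ^ (2 * (e + 2 * k)) - X ^ (2 * e)) / (X ^ 2 - 1))) := by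
  have hY : (p : ℝ) * X - 1 ≠ 0 := sub_ne_zero.mpr hpX
  have hX2 : X ^ 2 - 1 ≠ 0 := sub_ne_zero.mpr hX1
  induction k with
  | zero => simp
  | succ k ih =>
    rw [show e + 2 * (k + 1) = e + 2 * k + 2 by ring, Fp_add_two hp _ hX, ih, add_assoc,
      ← mul_add]
    generalize e + 2 * k = n
    have h1 : (((p : ℝ) * X) ^ (n + 2) - (p * X) ^ e) / (p * X - 1) =
        ((p * X) ^ n - (p * X) ^ e) / (p * X - 1) + (p * X) ^ n * (p * X + 1) := by
      rw [div_add' _ _ _ hY]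
      congr 1
      ring
    have h2 : (X ^ (2 * (n + 2)) - X ^ (2 * e)) / (X ^ 2 - 1) =
        (X ^ (2 * n) - X ^ (2 * e)) / (X ^ 2 - 1) + X ^ (2 * n) * (X ^ 2 + 1) := by
      rw [div_add' _ _ _ hX2]
      congr 1
      ring
    rw [h1, h2]
    ring

theorem statement18 (p : ℕ) (hp : p.Prime) (hodd : Odd p)
    (b : ℕ) (ε : ℕ) (hε : ε = if Even b then 0 else 1)
    (X : ℝ) (hXp : X ≠ (p : ℝ)) (hX1 : X ≠ 1) (hX2 : X ≠ -1) (hpX : (p : ℝ) * X ≠ 1) :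
    Fp p b b X
      = Fp p ε ε X
        + ((X + p) * (X - 1) / (X - p)) *
          ((p : ℝ) * X * (1 - p) *
              ((((p : ℝ) * X) ^ b - ((p : ℝ) * X) ^ ε) / ((p : ℝ) * X - 1))
            + X ^ 2 * ((p : ℝ) - (p : ℝ)⁻¹ * X) *
              ((X ^ (2 * b) - X ^ (2 * ε)) / (X ^ 2 - 1))) := by
  obtain ⟨k, rfl⟩ : ∃ k, b = ε + 2 * k := by
    rcases Nat.even_or_odd' b with ⟨k, rfl | rfl⟩
    · exact ⟨k, by simp [hε]⟩
    · exact ⟨k, by rw [hε, if_neg (by simp)]; ring⟩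
  exact Fp_diag_add_two_mul hp.two_le ε k hXp (by simp [sq_eq_one_iff, hX1, hX2]) hpX
end

section
/- Let a ≥ b ≥ 0 be integers with a + b even, and let F_p'(a,b;1) denote the derivative at X = 1 of the polynomial function X ↦ F_p(a,b;X). Then (p/(p+1)²) · ( −F_p'(a,b;1) + (p²/(1 − p²)) · (1 + p^{−1})(1 − p^{−2})·(p^{b+1} − 1)/(p − 1) ) = (a + b)/2 − p·(p^{b} − 1)/(p − 1). (Here −F_p'(a,b;1) equals the derived representation density α'(diag(p,1), diag(p^a,p^b)), and (1 + p^{−1})(1 − p^{−2})(p^{b+1} − 1)/(p − 1) is Nagaoka's value of the representation density α(Id₂, diag(p^a,p^b)); the right-hand side is the quantity μ_p(T) appearing as the local intersection number of Kudla–Rapoport divisors.) -/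
namespace Hironaka

/-- The local factor expressed through the conjugate-partition entries it depends on. -/
noncomputable def localFactor (p L₀ L₁ m₀ m₁ : ℕ) : ℚ :=
  ∑ i ∈ Finset.Icc m₁ (min L₁ m₀),
    (-(p : ℚ)) ^ (i * (2 * L₁ + 1 - i) / 2) * bsym p (L₁ - m₁) (L₁ - i) * bsym p (L₀ - i) (L₀ - m₀)

/-- The product of all local factors, for `λ̃ = (A, B)` and `μ = (c, d)`. -/
noncomputable def localProd (p A B c d : ℕ) : ℝ :=
  ∏ j ∈ Finset.range A,
    ((localFactor p (dualCt (A, B) (j + 1)) (dualCt (A, B) (j + 2))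
      (dualCt (c, d) (j + 1)) (dualCt (c, d) (j + 2)) : ℚ) : ℝ)

/-- A single term of the density polynomial, for `λ̃ = (A, B)` and `μ = (c, d)`. -/
noncomputable def densityTerm (p A B c d : ℕ) (X : ℝ) : ℝ :=
  (-1 : ℝ) ^ d * ((p : ℝ) ^ (2 * d + c))⁻¹ * X ^ (c + d) *
    (-(p : ℝ)) ^ (epsn c + epsn d) * localProd p A B c d

/-- The density polynomial, for `λ̃ = (A, B)`. -/
noncomputable def density (p A B : ℕ) (X : ℝ) : ℝ :=
  ∑ c ∈ Finset.range (A + 1), ∑ d ∈ Finset.range (min c B + 1), densityTerm p A B c d X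

/-- The part of the density polynomial indexed by `μ = (c, 0)` with `c ≥ 1`. -/
noncomputable def rowDensity (p A B : ℕ) (X : ℝ) : ℝ :=
  ∑ c ∈ Finset.range A, densityTerm p A B (c + 1) 0 X

theorem Fp_eq_density (p a b : ℕ) (X : ℝ) : Fp p a b X = density p (a + 1) (b + 1) X := by
  unfold Fp density densityTerm localProd
  refine Finset.sum_congr rfl fun c _ => Finset.sum_congr rfl fun d _ => ?_
  congr 1
  rw [Finset.range_eq_Ico, Finset.prod_Ico_add' (fun j => ((localFactor p
    (dualCt (a + 1, b + 1) j) (dualCt (a + 1, b + 1) (j + 1))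
      (dualCt (c, d) j) (dualCt (c, d) (j + 1)) : ℚ) : ℝ)) 0 (a + 1) 1]
  rfl

section Factors

variable {p : ℕ}

theorem one_sub_inv_pow_ne_zero (hp : 2 ≤ p) {i : ℕ} (hi : i ≠ 0) :
    1 - (-(p : ℚ))⁻¹ ^ i ≠ 0 := by
  have hp' : (2 : ℚ) ≤ p := by exact_mod_cast hp
  have h : |(-(p : ℚ))⁻¹ ^ i| < 1 := by
    rw [abs_pow, abs_inv, abs_neg, abs_of_nonneg (by linarith)]
    exact pow_lt_one₀ (by positivity) (inv_lt_one_of_one_lt₀ (by linarith)) hi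
  have := (abs_lt.1 h).2
  linarith

theorem prod_one_sub_inv_pow_ne_zero (hp : 2 ≤ p) (n : ℕ) :
    ∏ i ∈ Finset.Icc 1 n, (1 - (-(p : ℚ))⁻¹ ^ i) ≠ 0 :=
  Finset.prod_ne_zero_iff.2 fun i hi =>
    one_sub_inv_pow_ne_zero hp (by have := (Finset.mem_Icc.1 hi).1; lia)

theorem bsym_self (hp : 2 ≤ p) (u : ℕ) : bsym p u u = 1 := by
  have h := prod_one_sub_inv_pow_ne_zero hp u
  simp only [bsym, Nat.sub_self, Finset.Icc_eq_empty (show ¬ 1 ≤ 0 by lia),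
    Finset.prod_empty, mul_one, div_self h]

theorem bsym_zero_right (hp : 2 ≤ p) (u : ℕ) : bsym p u 0 = 1 := by
  have h := prod_one_sub_inv_pow_ne_zero hp u
  simp only [bsym, Nat.sub_zero, Finset.Icc_eq_empty (show ¬ 1 ≤ 0 by lia),
    Finset.prod_empty, one_mul, div_self h]

theorem bsym_two_one (hp : 2 ≤ p) : bsym p 2 1 = 1 - (p : ℚ)⁻¹ := by
  have h := prod_one_sub_inv_pow_ne_zero hp 1
  have h2 : Finset.Icc 1 2 = ({1, 2} : Finset ℕ) := rfl
  simp only [bsym, h2, Nat.add_one_sub_one]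
  rw [div_eq_iff (mul_ne_zero h h)]
  simp [inv_neg]
  ring

theorem localFactor_zero_zero (hp : 2 ≤ p) (L₀ L₁ : ℕ) : localFactor p L₀ L₁ 0 0 = 1 := by
  simp [localFactor, bsym_self hp]

theorem sum_Icc_zero_one (f : ℕ → ℚ) : ∑ i ∈ Finset.Icc 0 1, f i = f 0 + f 1 := by
  rw [show Finset.Icc 0 1 = Finset.range 2 from rfl, Finset.sum_range_succ, Finset.sum_range_one]

theorem sum_Icc_zero_two (f : ℕ → ℚ) : ∑ i ∈ Finset.Icc 0 2, f i = f 0 + f 1 + f 2 := by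
  rw [show Finset.Icc 0 2 = Finset.range 3 from rfl, Finset.sum_range_succ,
    Finset.sum_range_succ, Finset.sum_range_one]

theorem sum_Icc_one_two (f : ℕ → ℚ) : ∑ i ∈ Finset.Icc 1 2, f i = f 1 + f 2 := by
  rw [show Finset.Icc 1 2 = {1, 2} from rfl, Finset.sum_pair (by norm_num)]

theorem localFactor_two_two_one_zero (hp : 2 ≤ p) :
    localFactor p 2 2 1 0 = (1 + (p : ℚ) ^ 2) * (1 - (p : ℚ)⁻¹) := by
  simp [localFactor, sum_Icc_zero_one, bsym_self hp, bsym_two_one hp]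
  ring

theorem localFactor_two_two_one_one (hp : 2 ≤ p) : localFactor p 2 2 1 1 = (p : ℚ) ^ 2 := by
  simp [localFactor, bsym_self hp]

theorem localFactor_two_two_two_two (hp : 2 ≤ p) : localFactor p 2 2 2 2 = -(p : ℚ) ^ 3 := by
  simp [localFactor, bsym_self hp]
  ring

theorem localFactor_two_two_two_one (hp : 2 ≤ p) :
    localFactor p 2 2 2 1 = (p : ℚ) ^ 2 - (p : ℚ) ^ 3 := by
  simp [localFactor, sum_Icc_one_two, bsym_self hp, bsym_zero_right hp]
  ring

theorem localFactor_two_two_two_zero (hp : 2 ≤ p) :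
    localFactor p 2 2 2 0 = (1 - (p : ℚ)) * (1 + (p : ℚ) ^ 2) := by
  have h : (p : ℚ) ≠ 0 := by exact_mod_cast (by lia : p ≠ 0)
  simp [localFactor, sum_Icc_zero_two, bsym_self hp, bsym_zero_right hp, bsym_two_one hp]
  field_simp
  ring

theorem localFactor_two_one_one_zero (hp : 2 ≤ p) :
    localFactor p 2 1 1 0 = 1 - (p : ℚ)⁻¹ - p := by
  simp [localFactor, sum_Icc_zero_one, bsym_self hp, bsym_zero_right hp, bsym_two_one hp]
  ring

theorem localFactor_two_one_one_one (hp : 2 ≤ p) : localFactor p 2 1 1 1 = -(p : ℚ) := by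
  simp [localFactor, bsym_self hp]

theorem localFactor_two_one_two_one (hp : 2 ≤ p) : localFactor p 2 1 2 1 = -(p : ℚ) := by
  simp [localFactor, bsym_self hp, bsym_zero_right hp]

theorem localFactor_two_one_two_zero (hp : 2 ≤ p) : localFactor p 2 1 2 0 = 1 - (p : ℚ) := by
  simp [localFactor, sum_Icc_zero_one, bsym_self hp, bsym_zero_right hp]
  ring

theorem localFactor_one_one_one_zero (hp : 2 ≤ p) : localFactor p 1 1 1 0 = 1 - (p : ℚ) := by
  simp [localFactor, sum_Icc_zero_one, bsym_self hp, bsym_zero_right hp]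
  ring

theorem localFactor_one_one_one_one (hp : 2 ≤ p) : localFactor p 1 1 1 1 = -(p : ℚ) := by
  simp [localFactor, bsym_self hp]

theorem localFactor_one_zero_one_zero (hp : 2 ≤ p) : localFactor p 1 0 1 0 = 1 := by
  simp [localFactor, bsym_self hp, bsym_zero_right hp]

theorem localFactor_two_zero_one_zero (hp : 2 ≤ p) :
    localFactor p 2 0 1 0 = 1 - (p : ℚ)⁻¹ := by
  simp [localFactor, bsym_self hp, bsym_two_one hp]

theorem localFactor_two_zero_two_zero (hp : 2 ≤ p) : localFactor p 2 0 2 0 = 1 := by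
  simp [localFactor, bsym_self hp, bsym_zero_right hp]

theorem localProd_zero_zero (hp : 2 ≤ p) (A B : ℕ) : localProd p A B 0 0 = 1 := by
  simp [localProd, dualCt, localFactor_zero_zero hp]

theorem localProd_succ (p A B c d : ℕ) :
    localProd p (A + 1) B c d = localProd p A (B - 1) (c - 1) (d - 1) *
      ((localFactor p (dualCt (A + 1, B) 1) (dualCt (A + 1, B) 2)
        (dualCt (c, d) 1) (dualCt (c, d) 2) : ℚ) : ℝ) := by
  have key (x y j : ℕ) : dualCt (x, y) (j + 2) = dualCt (x - 1, y - 1) (j + 1) := by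
    have h (n : ℕ) : j + 2 ≤ n ↔ j + 1 ≤ n - 1 := by lia
    simp only [dualCt, h]
  rw [localProd, Finset.prod_range_succ']
  congr 1
  refine Finset.prod_congr rfl fun j _ => ?_
  rw [key (A + 1) B j, key (A + 1) B (j + 1), key c d j, key c d (j + 1)]
  rfl

end Factors

section Recursion

variable {p : ℕ}

theorem densityTerm_zero_zero (hp : 2 ≤ p) (A B : ℕ) (X : ℝ) : densityTerm p A B 0 0 X = 1 := by
  simp [densityTerm, epsn, localProd_zero_zero hp]

theorem density_eq_add (hp : 2 ≤ p) (A B : ℕ) (X : ℝ) :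
    density p A (B + 1) X = 1 + rowDensity p A (B + 1) X +
      ∑ c ∈ Finset.range A, ∑ d ∈ Finset.range (min c B + 1),
        densityTerm p A (B + 1) (c + 1) (d + 1) X := by
  rw [density, Finset.sum_range_succ', rowDensity, add_comm, add_assoc, ← Finset.sum_add_distrib]
  congr 1
  · simp [densityTerm_zero_zero hp]
  · refine Finset.sum_congr rfl fun c _ => ?_
    rw [show min (c + 1) (B + 1) = min c B + 1 by lia, Finset.sum_range_succ', add_comm]

theorem rowDensity_succ_zero (hp : 2 ≤ p) (A : ℕ) (X : ℝ) :
    rowDensity p (A + 2) 0 X = -(1 - p) * X - X * rowDensity p (A + 1) 0 X := by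
  have h0 : (p : ℝ) ≠ 0 := by exact_mod_cast (by lia : p ≠ 0)
  rw [rowDensity, Finset.sum_range_succ', rowDensity, Finset.mul_sum, add_comm, sub_eq_add_neg,
    ← Finset.sum_neg_distrib]
  congr 1
  · rw [densityTerm, localProd_succ]
    simp [epsn, localProd_zero_zero hp, dualCt,
      localFactor_one_one_one_zero hp]
    field_simp
    ring
  · refine Finset.sum_congr rfl fun c _ => ?_
    rw [densityTerm, localProd_succ]
    simp [densityTerm, epsn, dualCt, localFactor_one_one_one_one hp]
    field_simp
    ring

theorem rowDensity_one_zero (hp : 2 ≤ p) (X : ℝ) : rowDensity p 1 0 X = -X := by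
  have h0 : (p : ℝ) ≠ 0 := by exact_mod_cast (by lia : p ≠ 0)
  simp [rowDensity, densityTerm, epsn, localProd_succ, localProd_zero_zero hp, dualCt,
    localFactor_one_zero_one_zero hp]
  field_simp

theorem rowDensity_one_one (hp : 2 ≤ p) (X : ℝ) :
    rowDensity p 1 1 X = -(1 - (p : ℝ)⁻¹) * X := by
  have h0 : (p : ℝ) ≠ 0 := by exact_mod_cast (by lia : p ≠ 0)
  simp [rowDensity, densityTerm, epsn, localProd_succ, localProd_zero_zero hp, dualCt,
    localFactor_two_zero_one_zero hp]
  field_simp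
  ring

theorem density_one_one (hp : 2 ≤ p) (X : ℝ) :
    density p 1 1 X = 1 - (1 - (p : ℝ)⁻¹) * X - (p : ℝ)⁻¹ * X ^ 2 := by
  have h0 : (p : ℝ) ≠ 0 := by exact_mod_cast (by lia : p ≠ 0)
  rw [density_eq_add hp, rowDensity_one_one hp]
  simp [densityTerm, epsn, localProd_succ, localProd_zero_zero hp, dualCt,
    localFactor_two_zero_two_zero hp]
  field_simp
  ring

theorem rowDensity_succ_one (hp : 2 ≤ p) (A : ℕ) (X : ℝ) :
    rowDensity p (A + 2) 1 X =
      -(1 - (p : ℝ)⁻¹ - p) * X - X * rowDensity p (A + 1) 0 X := by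
  have h0 : (p : ℝ) ≠ 0 := by exact_mod_cast (by lia : p ≠ 0)
  rw [rowDensity, Finset.sum_range_succ', rowDensity, Finset.mul_sum, add_comm, sub_eq_add_neg,
    ← Finset.sum_neg_distrib]
  congr 1
  · rw [densityTerm, localProd_succ]
    simp [epsn, localProd_zero_zero hp, dualCt,
      localFactor_two_one_one_zero hp]
    field_simp
    ring
  · refine Finset.sum_congr rfl fun c _ => ?_
    rw [densityTerm, localProd_succ]
    simp [densityTerm, epsn, dualCt, localFactor_two_one_one_one hp]
    field_simp
    ring

theorem density_succ_one (hp : 2 ≤ p) (A : ℕ) (X : ℝ) :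
    density p (A + 2) 1 X = 1 - (1 - (p : ℝ)⁻¹ - p) * X - X * rowDensity p (A + 1) 0 X
      - (p : ℝ)⁻¹ * X ^ 2 * (1 - p + rowDensity p (A + 1) 0 X) := by
  have h0 : (p : ℝ) ≠ 0 := by exact_mod_cast (by lia : p ≠ 0)
  have key : ∑ c ∈ Finset.range (A + 2), ∑ d ∈ Finset.range (min c 0 + 1),
      densityTerm p (A + 2) 1 (c + 1) (d + 1) X =
      -(p : ℝ)⁻¹ * X ^ 2 * (1 - p + rowDensity p (A + 1) 0 X) := by
    simp only [Nat.min_zero, zero_add, Finset.sum_range_one]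
    rw [Finset.sum_range_succ', rowDensity, mul_add, Finset.mul_sum, add_comm]
    congr 1
    · rw [densityTerm, localProd_succ]
      simp [epsn, localProd_zero_zero hp, dualCt,
        localFactor_two_one_two_zero hp]
      field_simp
      simp
    · refine Finset.sum_congr rfl fun c _ => ?_
      rw [densityTerm, localProd_succ]
      simp [densityTerm, epsn, dualCt, localFactor_two_one_two_one hp]
      field_simp
      ring
  rw [density_eq_add hp, rowDensity_succ_one hp, key]
  ring

theorem rowDensity_succ_succ (hp : 2 ≤ p) (A B : ℕ) (X : ℝ) :
    rowDensity p (A + 2) (B + 2) X =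
      p * X * rowDensity p (A + 1) (B + 1) X - (1 + (p : ℝ) ^ 2) * (1 - (p : ℝ)⁻¹) * X := by
  have h0 : (p : ℝ) ≠ 0 := by exact_mod_cast (by lia : p ≠ 0)
  rw [rowDensity, Finset.sum_range_succ', rowDensity, Finset.mul_sum, sub_eq_add_neg]
  congr 1
  · refine Finset.sum_congr rfl fun c _ => ?_
    rw [densityTerm, localProd_succ]
    simp [densityTerm, epsn, dualCt, localFactor_two_two_one_one hp]
    field_simp
    ring
  · rw [densityTerm, localProd_succ]
    simp [epsn, localProd_zero_zero hp, dualCt,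
      localFactor_two_two_one_zero hp]
    field_simp

theorem densityTerm_succ_succ (hp : 2 ≤ p) (A B : ℕ) {c d : ℕ} (hdc : d ≤ c) (X : ℝ) :
    densityTerm p (A + 2) (B + 2) (c + 1) (d + 1) X = X ^ 2 * (densityTerm p (A + 1) (B + 1) c d X +
      if d = 0 then (if c = 0 then (1 + (p : ℝ) ^ 2) * (1 - (p : ℝ)⁻¹) - 1
        else -p * densityTerm p (A + 1) (B + 1) c 0 X) else 0) := by
  have h0 : (p : ℝ) ≠ 0 := by exact_mod_cast (by lia : p ≠ 0)
  rw [densityTerm, localProd_succ]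
  rcases c with _ | c <;> rcases d with _ | d
  · simp [densityTerm, epsn, localProd_zero_zero hp, dualCt, localFactor_two_two_two_zero hp]
    field_simp
    ring
  · lia
  · simp [densityTerm, epsn, dualCt, localFactor_two_two_two_one hp]
    field_simp
    ring
  · simp [densityTerm, epsn, dualCt, localFactor_two_two_two_two hp]
    field_simp
    ring

theorem density_succ_succ (hp : 2 ≤ p) (A B : ℕ) (X : ℝ) :
    density p (A + 2) (B + 2) X = 1 + rowDensity p (A + 2) (B + 2) X +
      X ^ 2 * (density p (A + 1) (B + 1) X - p * rowDensity p (A + 1) (B + 1) X +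
        ((1 + (p : ℝ) ^ 2) * (1 - (p : ℝ)⁻¹) - 1)) := by
  rw [density_eq_add hp]
  congr 1
  have key : ∀ c ∈ Finset.range (A + 2), ∑ d ∈ Finset.range (min c (B + 1) + 1),
      densityTerm p (A + 2) (B + 2) (c + 1) (d + 1) X =
      X ^ 2 * (∑ d ∈ Finset.range (min c (B + 1) + 1), densityTerm p (A + 1) (B + 1) c d X +
        if c = 0 then (1 + (p : ℝ) ^ 2) * (1 - (p : ℝ)⁻¹) - 1
          else -p * densityTerm p (A + 1) (B + 1) c 0 X) := by
    intro c _
    rw [Finset.sum_congr rfl fun d hd => densityTerm_succ_succ hp A B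
      (by have := Finset.mem_range.1 hd; lia) X, ← Finset.mul_sum, Finset.sum_add_distrib]
    simp
  rw [Finset.sum_congr rfl key, ← Finset.mul_sum, Finset.sum_add_distrib, ← density,
    Finset.sum_range_succ' (fun c => if c = 0 then _ else _), rowDensity]
  simp [Finset.mul_sum, sub_eq_add_neg, add_assoc]

end Recursion

section Derivative

variable {p : ℕ}

theorem rowDensity_even_zero_at_one (hp : 2 ≤ p) (m : ℕ) :
    rowDensity p (2 * m + 2) 0 1 = p ∧
      HasDerivAt (rowDensity p (2 * m + 2) 0) ((m + 1) * (p + 1)) 1 := by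
  have step (A : ℕ) (v w : ℝ) (hv : rowDensity p (A + 1) 0 1 = v)
      (hw : HasDerivAt (rowDensity p (A + 1) 0) w 1) :
      rowDensity p (A + 2) 0 1 = -(1 - p) - v ∧
        HasDerivAt (rowDensity p (A + 2) 0) (-(1 - p) - v - w) 1 := by
    refine ⟨by rw [rowDensity_succ_zero hp, hv]; ring, ?_⟩
    rw [funext (rowDensity_succ_zero hp A)]
    have h := ((hasDerivAt_id (1 : ℝ)).const_mul (-(1 - (p : ℝ)))).sub
      ((hasDerivAt_id (1 : ℝ)).mul hw)
    refine h.congr_deriv ?_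
    simp [hv]
    ring
  induction m with
  | zero =>
    have h := step 0 (-1) (-1) (rowDensity_one_zero hp 1)
      (by rw [funext (rowDensity_one_zero hp)]; exact (hasDerivAt_id (1 : ℝ)).neg)
    refine ⟨h.1.trans (by ring), ?_⟩
    refine h.2.congr_deriv ?_
    push_cast
    ring
  | succ m ih =>
    have h₁ := step (2 * m + 1) _ _ ih.1 ih.2
    have h₂ := step (2 * m + 2) _ _ h₁.1 h₁.2
    refine ⟨h₂.1.trans (by ring), ?_⟩
    refine h₂.2.congr_deriv ?_
    push_cast
    ring

theorem density_one_at_one (hp : 2 ≤ p) (m : ℕ) :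
    rowDensity p (2 * m + 1) 1 1 = -1 + (p : ℝ)⁻¹ ∧ density p (2 * m + 1) 1 1 = 0 ∧
      HasDerivAt (density p (2 * m + 1) 1)
        (-1 - (p : ℝ)⁻¹ - m * ((p : ℝ) + 1) ^ 2 * (p : ℝ)⁻¹) 1 := by
  have h0 : (p : ℝ) ≠ 0 := by exact_mod_cast (by lia : p ≠ 0)
  rcases m with _ | m
  · refine ⟨by rw [rowDensity_one_one hp]; ring, by rw [density_one_one hp]; ring, ?_⟩
    simp only [mul_zero, zero_add]
    rw [funext (density_one_one hp)]
    have h := (((hasDerivAt_id (1 : ℝ)).const_mul (1 - (p : ℝ)⁻¹)).const_sub 1).sub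
      ((hasDerivAt_pow 2 (1 : ℝ)).const_mul (p : ℝ)⁻¹)
    refine h.congr_deriv ?_
    simp
    ring
  · obtain ⟨hv, hw⟩ := rowDensity_even_zero_at_one hp m
    rw [show 2 * (m + 1) + 1 = 2 * m + 1 + 2 by ring]
    rw [show 2 * m + 2 = 2 * m + 1 + 1 from rfl] at hv hw
    refine ⟨by rw [rowDensity_succ_one hp, hv]; ring,
      by rw [density_succ_one hp, hv]; field_simp; ring, ?_⟩
    rw [funext (density_succ_one hp (2 * m + 1))]
    have h := ((((hasDerivAt_id (1 : ℝ)).const_mul (1 - (p : ℝ)⁻¹ - p)).const_sub 1).sub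
      ((hasDerivAt_id (1 : ℝ)).mul hw)).sub
      (((hasDerivAt_pow 2 (1 : ℝ)).const_mul (p : ℝ)⁻¹).mul (hw.const_add (1 - (p : ℝ))))
    refine h.congr_deriv ?_
    simp [hv]
    field_simp
    ring

theorem differentiable_rowDensity (p A B : ℕ) : Differentiable ℝ (rowDensity p A B) := by
  unfold rowDensity densityTerm
  fun_prop

theorem density_at_one (hp : 2 ≤ p) (m n : ℕ) :
    rowDensity p (n + 2 * m + 1) (n + 1) 1 =
        (1 + (p : ℝ) ^ 2) * (p : ℝ)⁻¹ - (p + 1) * (p : ℝ) ^ n ∧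
      density p (n + 2 * m + 1) (n + 1) 1 = 0 ∧
      HasDerivAt (density p (n + 2 * m + 1) (n + 1))
        (-1 - (p : ℝ)⁻¹ - (n + m) * ((p : ℝ) + 1) ^ 2 * (p : ℝ)⁻¹
          + (p + 1) * p * (((p : ℝ) ^ n - 1) / (p - 1))) 1 := by
  have h0 : (p : ℝ) ≠ 0 := by exact_mod_cast (by lia : p ≠ 0)
  have h1 : (p : ℝ) - 1 ≠ 0 := sub_ne_zero.2 (by exact_mod_cast (by lia : p ≠ 1))
  induction n with
  | zero =>
    obtain ⟨hr, hd, hD⟩ := density_one_at_one hp m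
    simp only [zero_add]
    refine ⟨by rw [hr]; field_simp; ring, hd, ?_⟩
    convert hD using 1
    simp
  | succ n ih =>
    obtain ⟨hr, hd, hD⟩ := ih
    rw [show n + 1 + 2 * m + 1 = n + 2 * m + 2 by ring]
    have hR := (differentiable_rowDensity p (n + 2 * m + 1) (n + 1) 1).hasDerivAt
    refine ⟨by rw [rowDensity_succ_succ hp, hr]; field_simp; ring,
      by rw [density_succ_succ hp, rowDensity_succ_succ hp, hd]; ring, ?_⟩
    rw [funext (density_succ_succ hp (n + 2 * m) n),
      funext (rowDensity_succ_succ hp (n + 2 * m) n)]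
    have h := (((((hasDerivAt_id (1 : ℝ)).const_mul (p : ℝ)).mul hR).sub
      ((hasDerivAt_id (1 : ℝ)).const_mul ((1 + (p : ℝ) ^ 2) * (1 - (p : ℝ)⁻¹)))).const_add 1).add
      ((hasDerivAt_pow 2 (1 : ℝ)).mul ((hD.sub (hR.const_mul (p : ℝ))).add_const
        ((1 + (p : ℝ) ^ 2) * (1 - (p : ℝ)⁻¹) - 1)))
    refine h.congr_deriv ?_
    simp [hr, hd]
    field_simp
    ring

end Derivative

end Hironaka

theorem statement19 (p : ℕ) (hp : p.Prime) (hodd : Odd p)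
    (a b : ℕ) (hba : b ≤ a) (hev : Even (a + b)) :
    ((p : ℝ) / ((p : ℝ) + 1) ^ 2) *
        (-(deriv (fun X : ℝ => Fp p a b X) 1)
          + ((p : ℝ) ^ 2 / (1 - (p : ℝ) ^ 2)) *
            ((1 + (p : ℝ)⁻¹) * (1 - ((p : ℝ) ^ 2)⁻¹) *
              (((p : ℝ) ^ (b + 1) - 1) / ((p : ℝ) - 1))))
      = ((a : ℝ) + (b : ℝ)) / 2 - (p : ℝ) * (((p : ℝ) ^ b - 1) / ((p : ℝ) - 1)) := by
  obtain ⟨m, rfl⟩ : ∃ m, a = b + 2 * m := by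
    obtain ⟨r, hr⟩ := hev
    exact ⟨r - b, by lia⟩
  have h0 : (p : ℝ) ≠ 0 := by exact_mod_cast hp.ne_zero
  have h1 : (p : ℝ) - 1 ≠ 0 := sub_ne_zero.2 (by exact_mod_cast hp.ne_one)
  have h2 : (p : ℝ) + 1 ≠ 0 := by positivity
  have h3 : 1 - (p : ℝ) ^ 2 ≠ 0 := by
    rw [show 1 - (p : ℝ) ^ 2 = -((p - 1) * (p + 1)) by ring]
    exact neg_ne_zero.2 (mul_ne_zero h1 h2)
  simp only [Hironaka.Fp_eq_density]
  rw [(Hironaka.density_at_one hp.two_le m b).2.2.deriv]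
  push_cast
  field_simp
  ring
end
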